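/- Let χ be the characteristic function of the practical numbers and θ(n) = σ(n) + 1. For N ≥ 1 define ε_N = Σ_{n > N} χ(n)·(1/n)·∏_{p ≤ θ(n)} (1 − 1/p) and V_N = Σ_{n > N} χ(n)·(1/n)·(Σ_{q ≤ θ(n)} W_q)·∏_{p ≤ θ(n)} (1 − 1/p), where for a prime q, W_q := Σ_{h ≥ 1} ((1 − 1/q)/q^h)·log((1 − 1/q^{h+1})/(1 − 1/q)). Then ε_N·Σ_{q ≤ 2N} W_q < V_N < ε_N·(Σ_{q ≤ 2N} W_q + 1/(2N)), where q runs over primes. -/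

import Mathlib

open scoped BigOperators
open Classical

/-- A positive integer `n` is practical if every positive integer `m ≤ n` can be
expressed as a sum of distinct positive divisors of `n`. -/
def Practical (n : ℕ) : Prop :=
  0 < n ∧ ∀ m : ℕ, 0 < m → m ≤ n → ∃ s : Finset ℕ, s ⊆ n.divisors ∧ ∑ d ∈ s, d = m

/-- The sum of the positive divisors of `n`. -/
def sigma1 (n : ℕ) : ℕ := ∑ d ∈ n.divisors, d

/-- The set of primes `p ≤ x`. -/
noncomputable def primesUpTo (x : ℝ) : Finset ℕ := (Finset.Iic ⌊x⌋₊).filter Nat.Prime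

/-- `∏_{p ≤ σ(n)+1} (1 − 1/p)`, the product over primes `p ≤ θ(n) = σ(n) + 1`. -/
noncomputable def primeProd (n : ℕ) : ℝ :=
  ∏ p ∈ primesUpTo ((sigma1 n : ℝ) + 1), (1 - 1 / (p : ℝ))

/-- `W_q = Σ_{h ≥ 1} ((1 − 1/q)/q^h)·log((1 − 1/q^{h+1})/(1 − 1/q))`
(the index `h : ℕ` below corresponds to `h + 1 ≥ 1`). -/
noncomputable def W (q : ℕ) : ℝ :=
  ∑' h : ℕ, ((1 - 1 / (q : ℝ)) / (q : ℝ) ^ (h + 1)) *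
    Real.log ((1 - 1 / (q : ℝ) ^ (h + 2)) / (1 - 1 / (q : ℝ)))

theorem mem_primesUpTo_natCast {k q : ℕ} : q ∈ primesUpTo (k : ℝ) ↔ q.Prime ∧ q ≤ k := by
  simp [primesUpTo, and_comm]

theorem mem_primesUpTo_theta {n q : ℕ} :
    q ∈ primesUpTo ((sigma1 n : ℝ) + 1) ↔ q.Prime ∧ q ≤ sigma1 n + 1 := by
  rw [← mem_primesUpTo_natCast]
  push_cast
  rfl

theorem self_le_sigma1 {n : ℕ} (hn : 0 < n) : n ≤ sigma1 n :=
  Finset.single_le_sum (f := fun d : ℕ => d) (fun _ _ => Nat.zero_le _)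
    (Nat.mem_divisors_self n hn.ne')

theorem Practical.two_mul_le {n : ℕ} (hn : Practical n) (h2 : 2 ≤ n) :
    2 * n ≤ sigma1 n + 1 := by
  obtain ⟨s, hs, hsum⟩ := hn.2 (n - 1) (by omega) (by omega)
  have hns : n ∉ s := fun h => by
    have := Finset.single_le_sum (f := fun d : ℕ => d) (fun _ _ => Nat.zero_le _) h
    omega
  have h := Finset.sum_le_sum_of_subset (f := fun d : ℕ => d)
    (Finset.insert_subset (Nat.mem_divisors_self n hn.1.ne') hs)
  rw [Finset.sum_insert hns, hsum] at h
  unfold sigma1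
  omega

theorem practical_two_pow (k : ℕ) : Practical (2 ^ k) := by
  refine ⟨by positivity, fun m _ hmk => ?_⟩
  have hsum : ∑ i ∈ m.bitIndices.toFinset, 2 ^ i = m := by
    rw [List.sum_toFinset _ (Nat.bitIndices_sorted.nodup), Nat.sum_map_two_pow_bitIndices]
  refine ⟨m.bitIndices.toFinset.image (2 ^ ·), ?_, ?_⟩
  · intro d hd
    obtain ⟨i, hi, rfl⟩ := Finset.mem_image.1 hd
    have h1 : 2 ^ i ≤ m := Nat.two_pow_le_of_mem_bitIndices (List.mem_toFinset.1 hi)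
    have h2 : i ≤ k := (Nat.pow_le_pow_iff_right (by norm_num)).1 (h1.trans hmk)
    exact Nat.mem_divisors.2 ⟨pow_dvd_pow 2 h2, by positivity⟩
  · rw [Finset.sum_image fun a _ b _ h => Nat.pow_right_injective le_rfl h, hsum]

/-- The product of the primes up to `θ(n) = σ(n) + 1`. -/
noncomputable def thetaPrimorial (n : ℕ) : ℕ := ∏ p ∈ primesUpTo ((sigma1 n : ℝ) + 1), p

theorem primeFactors_thetaPrimorial (n : ℕ) :
    (thetaPrimorial n).primeFactors = primesUpTo ((sigma1 n : ℝ) + 1) :=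
  Nat.primeFactors_prod fun _ hp => (mem_primesUpTo_theta.1 hp).1

theorem thetaPrimorial_pos (n : ℕ) : 0 < thetaPrimorial n :=
  Finset.prod_pos fun _ hp => (mem_primesUpTo_theta.1 hp).1.pos

theorem totient_thetaPrimorial (n : ℕ) :
    ((thetaPrimorial n).totient : ℝ) = thetaPrimorial n * primeProd n := by
  have h := Nat.totient_eq_mul_prod_factors (thetaPrimorial n)
  have h' := congrArg (Rat.cast : ℚ → ℝ) h
  push_cast at h'
  rw [h', primeFactors_thetaPrimorial, primeProd]
  simp only [one_div]

theorem lt_of_prime_of_dvd_of_coprime {n m p : ℕ} (hm : (thetaPrimorial n).Coprime m)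
    (hp : p.Prime) (hpm : p ∣ m) : sigma1 n + 1 < p := by
  by_contra! h
  exact hp.one_lt.ne' (Nat.eq_one_of_dvd_coprimes hm
    (Finset.dvd_prod_of_mem _ (mem_primesUpTo_theta.2 ⟨hp, h⟩)) hpm)

theorem Practical.eq_of_mul_eq_of_le {n n' m m' : ℕ} (hn : Practical n) (hn' : Practical n')
    (hm : (thetaPrimorial n).Coprime m) (hm' : (thetaPrimorial n').Coprime m')
    (h : n * m = n' * m') (hle : sigma1 n ≤ sigma1 n') : n = n' := by
  have hcop : n.Coprime m' := Nat.coprime_of_dvd fun p hp hpn hpm => by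
    have h1 := lt_of_prime_of_dvd_of_coprime hm' hp hpm
    have h2 := Nat.le_of_dvd hn.1 hpn
    have h3 := self_le_sigma1 hn.1
    omega
  obtain ⟨r, rfl⟩ := hcop.dvd_of_dvd_mul_right (h ▸ dvd_mul_right n m : n ∣ n' * m')
  have hrm : r ∣ m := ⟨m', Nat.eq_of_mul_eq_mul_left hn.1 (by rw [h, mul_assoc])⟩
  have hr0 : 0 < r := Nat.pos_of_mul_pos_left hn'.1
  have hbig : ∀ d, d ∣ r → d ≠ 1 → sigma1 n + 1 < d := fun d hd hd1 =>
    (lt_of_prime_of_dvd_of_coprime hm (Nat.minFac_prime hd1)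
      ((Nat.minFac_dvd d).trans (hd.trans hrm))).trans_le
      (Nat.minFac_le (Nat.pos_of_dvd_of_pos hd hr0))
  by_contra hne
  have hr1 : r ≠ 1 := fun h1 => hne (by rw [h1, mul_one])
  have hrb := hbig r dvd_rfl hr1
  obtain ⟨s, hs, hsum⟩ := hn'.2 (sigma1 n + 1) (by omega)
    (hrb.le.trans (Nat.le_mul_of_pos_left r hn.1))
  have hsub : s ⊆ n.divisors := by
    intro d hd
    have hdle := Finset.single_le_sum (f := fun d : ℕ => d) (fun _ _ => Nat.zero_le _) hd
    simp only [hsum] at hdle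
    obtain ⟨a, b, ha, hb, rfl⟩ := exists_dvd_and_dvd_of_dvd_mul (Nat.dvd_of_mem_divisors (hs hd))
    have ha0 := Nat.pos_of_dvd_of_pos ha hn.1
    by_cases hb1 : b = 1
    · subst hb1
      simpa using ⟨ha, hn.1.ne'⟩
    · have := hbig b hb hb1
      have := Nat.le_mul_of_pos_left b ha0
      omega
  have := Finset.sum_le_sum_of_subset (f := fun d : ℕ => d) hsub
  rw [hsum] at this
  unfold sigma1 at this
  omega

theorem Practical.eq_of_mul_eq {n n' m m' : ℕ} (hn : Practical n) (hn' : Practical n')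
    (hm : (thetaPrimorial n).Coprime m) (hm' : (thetaPrimorial n').Coprime m')
    (h : n * m = n' * m') : n = n' := by
  rcases le_total (sigma1 n) (sigma1 n') with hle | hle
  · exact hn.eq_of_mul_eq_of_le hn' hm hm' h hle
  · exact (hn'.eq_of_mul_eq_of_le hn hm' hm h.symm hle).symm

theorem card_filter_coprime_range_mul (a c : ℕ) :
    ((Finset.range (a * c)).filter a.Coprime).card = c * a.totient := by
  induction c with
  | zero => simp
  | succ c ih =>
    rw [Finset.range_eq_Ico] at ih ⊢
    rw [← Finset.Ico_union_Ico_eq_Ico (Nat.zero_le (a * c))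
      (Nat.mul_le_mul_left a (Nat.le_add_right c 1)), Finset.filter_union,
      Finset.card_union_of_disjoint (Finset.disjoint_filter_filter
        (Finset.Ico_disjoint_Ico_consecutive _ _ _)), ih, mul_add_one a c,
      Nat.filter_coprime_Ico_eq_totient]
    ring

theorem primeProd_pos (n : ℕ) : 0 < primeProd n :=
  Finset.prod_pos fun p hp => by
    have : (1 : ℝ) < p := by exact_mod_cast (mem_primesUpTo_theta.1 hp).1.one_lt
    rw [sub_pos, div_lt_one] <;> linarith

theorem sum_practical_le_one (F : Finset ℕ) (hF : ∀ n ∈ F, Practical n) :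
    ∑ n ∈ F, 1 / (n : ℝ) * primeProd n ≤ 1 := by
  set M : ℕ := ∏ n ∈ F, n * thetaPrimorial n with hM
  have hMpos : 0 < M := Finset.prod_pos fun n hn => Nat.mul_pos (hF n hn).1 (thetaPrimorial_pos n)
  let B : ℕ → Finset ℕ := fun n =>
    ((Finset.range (M / n)).filter (thetaPrimorial n).Coprime).image (n * ·)
  have hcard : ∀ n ∈ F, ((B n).card : ℝ) = M * (1 / (n : ℝ) * primeProd n) := by
    intro n hn
    have hn0 := (hF n hn).1
    obtain ⟨c, hc⟩ : n * thetaPrimorial n ∣ M := Finset.dvd_prod_of_mem _ hn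
    have hdiv : M / n = thetaPrimorial n * c := by
      rw [hc, mul_assoc, Nat.mul_div_cancel_left _ hn0]
    simp only [B]
    rw [Finset.card_image_of_injective _ fun a b h => Nat.eq_of_mul_eq_mul_left hn0 h, hdiv,
      card_filter_coprime_range_mul, hc]
    push_cast
    rw [totient_thetaPrimorial]
    have : (n : ℝ) ≠ 0 := by exact_mod_cast hn0.ne'
    field_simp
  have hdisj : (F : Set ℕ).PairwiseDisjoint B := by
    intro n hn n' hn' hne
    refine Finset.disjoint_left.2 fun k hk hk' => hne ?_
    obtain ⟨m, hm, rfl⟩ := Finset.mem_image.1 hk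
    obtain ⟨m', hm', h⟩ := Finset.mem_image.1 hk'
    exact (hF n hn).eq_of_mul_eq (hF n' hn') (Finset.mem_filter.1 hm).2
      (Finset.mem_filter.1 hm').2 h.symm
  have hsub : F.biUnion B ⊆ Finset.range M := by
    refine Finset.biUnion_subset.2 fun n hn k hk => ?_
    obtain ⟨m, hm, rfl⟩ := Finset.mem_image.1 hk
    have h1 := Finset.mem_range.1 (Finset.mem_filter.1 hm).1
    rw [Finset.mem_range]
    exact (Nat.mul_lt_mul_of_pos_left h1 (hF n hn).1).trans_le (Nat.mul_div_le M n)
  have h := Finset.card_le_card hsub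
  rw [Finset.card_biUnion hdisj, Finset.card_range] at h
  have h' : ((∑ n ∈ F, (B n).card : ℕ) : ℝ) ≤ M := by exact_mod_cast h
  push_cast at h'
  rw [Finset.sum_congr rfl hcard, ← Finset.mul_sum] at h'
  have hMr : (0 : ℝ) < M := by exact_mod_cast hMpos
  exact le_of_mul_le_mul_left (by linarith) hMr

theorem summable_practical_tail (N : ℕ) :
    Summable fun n : ℕ => if Practical n ∧ N < n then 1 / (n : ℝ) * primeProd n else 0 := by
  have hnonneg : ∀ n : ℕ, 0 ≤ 1 / (n : ℝ) * primeProd n := fun n =>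
    mul_nonneg (by positivity) (primeProd_pos n).le
  refine summable_of_sum_le (c := 1) (fun n => ?_) fun F => ?_
  · dsimp only
    split_ifs
    · exact hnonneg n
    · rfl
  · rw [← Finset.sum_filter]
    exact sum_practical_le_one _ fun n hn => (Finset.mem_filter.1 hn).2.1

section LogSeries

variable {q : ℕ}

theorem W_term_nonneg (hq : 2 ≤ q) (h : ℕ) :
    0 ≤ ((1 - 1 / (q : ℝ)) / (q : ℝ) ^ (h + 1)) *
      Real.log ((1 - 1 / (q : ℝ) ^ (h + 2)) / (1 - 1 / (q : ℝ))) := by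
  have hq' : (2 : ℝ) ≤ q := by exact_mod_cast hq
  have h1 : 0 < 1 - 1 / (q : ℝ) := by
    rw [sub_pos, div_lt_one] <;> linarith
  have h2 : 1 / (q : ℝ) ^ (h + 2) ≤ 1 / q :=
    one_div_le_one_div_of_le (by linarith) (le_self_pow₀ (by linarith) (by omega))
  refine mul_nonneg (by positivity) (Real.log_nonneg ?_)
  rw [one_le_div h1]
  linarith

theorem W_term_zero_pos (hq : 2 ≤ q) :
    0 < ((1 - 1 / (q : ℝ)) / (q : ℝ) ^ (0 + 1)) *
      Real.log ((1 - 1 / (q : ℝ) ^ (0 + 2)) / (1 - 1 / (q : ℝ))) := by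
  have hq' : (2 : ℝ) ≤ q := by exact_mod_cast hq
  have h1 : 0 < 1 - 1 / (q : ℝ) := by
    rw [sub_pos, div_lt_one] <;> linarith
  have h2 : 1 / (q : ℝ) ^ (0 + 2) < 1 / q :=
    one_div_lt_one_div_of_lt (by linarith) (lt_self_pow₀ (by linarith) (by omega))
  refine mul_pos (by positivity) (Real.log_pos ?_)
  rw [one_lt_div h1]
  linarith

theorem W_term_le (hq : 2 ≤ q) (h : ℕ) :
    ((1 - 1 / (q : ℝ)) / (q : ℝ) ^ (h + 1)) *
      Real.log ((1 - 1 / (q : ℝ) ^ (h + 2)) / (1 - 1 / (q : ℝ))) ≤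
      (1 / (q : ℝ)) ^ 2 * (1 / (q : ℝ)) ^ h := by
  have hq' : (2 : ℝ) ≤ q := by exact_mod_cast hq
  have h1 : 0 < 1 - 1 / (q : ℝ) := by
    rw [sub_pos, div_lt_one] <;> linarith
  have h3 : 1 / (q : ℝ) ^ (h + 2) ≤ 1 / q :=
    one_div_le_one_div_of_le (by linarith) (le_self_pow₀ (by linarith) (by omega))
  have h2 : 0 < 1 - 1 / (q : ℝ) ^ (h + 2) := by linarith
  have hpos : 0 < 1 / (q : ℝ) ^ (h + 2) := by positivity
  have hlog : Real.log ((1 - 1 / (q : ℝ) ^ (h + 2)) / (1 - 1 / (q : ℝ))) ≤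
      1 / (q : ℝ) / (1 - 1 / (q : ℝ)) := by
    refine (Real.log_le_sub_one_of_pos (div_pos h2 h1)).trans ?_
    rw [div_sub_one h1.ne']
    exact div_le_div_of_nonneg_right (by linarith) h1.le
  refine (mul_le_mul_of_nonneg_left hlog (by positivity)).trans (le_of_eq ?_)
  rw [div_mul_div_comm, mul_comm ((q : ℝ) ^ (h + 1)), mul_div_mul_left _ _ h1.ne', ← pow_add,
    one_div_pow, div_div, ← pow_succ']
  ring_nf

theorem hasSum_W_bound (hq : 2 ≤ q) :
    HasSum (fun h : ℕ => (1 / (q : ℝ)) ^ 2 * (1 / (q : ℝ)) ^ h)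
      (1 / ((q : ℝ) - 1) - 1 / (q : ℝ)) := by
  have hq' : (2 : ℝ) ≤ q := by exact_mod_cast hq
  have h1 : 1 / (q : ℝ) < 1 := by rw [div_lt_one] <;> linarith
  have hne : (q : ℝ) - 1 ≠ 0 := by linarith
  have hne' : 1 - 1 / (q : ℝ) ≠ 0 := by linarith
  have hval : 1 / ((q : ℝ) - 1) - 1 / (q : ℝ) = (1 / (q : ℝ)) ^ 2 * (1 - 1 / (q : ℝ))⁻¹ := by
    rw [← div_eq_mul_inv, eq_div_iff hne']
    field_simp
    ring
  rw [hval]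
  exact (hasSum_geometric_of_lt_one (by positivity) h1).mul_left _

theorem summable_W (hq : 2 ≤ q) :
    Summable fun h : ℕ => ((1 - 1 / (q : ℝ)) / (q : ℝ) ^ (h + 1)) *
      Real.log ((1 - 1 / (q : ℝ) ^ (h + 2)) / (1 - 1 / (q : ℝ))) :=
  .of_nonneg_of_le (W_term_nonneg hq) (W_term_le hq) (hasSum_W_bound hq).summable

theorem W_pos (hq : 2 ≤ q) : 0 < W q :=
  (summable_W hq).tsum_pos (W_term_nonneg hq) 0 (W_term_zero_pos hq)

theorem W_le (hq : 2 ≤ q) : W q ≤ 1 / ((q : ℝ) - 1) - 1 / (q : ℝ) :=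
  hasSum_le (W_term_le hq) (summable_W hq).hasSum (hasSum_W_bound hq)

end LogSeries

theorem primesUpTo_natCast_subset {a b : ℕ} (hab : a ≤ b) :
    primesUpTo (a : ℝ) ⊆ primesUpTo (b : ℝ) := fun q hq => by
  rw [mem_primesUpTo_natCast] at hq ⊢
  exact ⟨hq.1, hq.2.trans hab⟩

theorem sum_W_le_sum_W {a b : ℕ} (hab : a ≤ b) :
    ∑ q ∈ primesUpTo (a : ℝ), W q ≤ ∑ q ∈ primesUpTo (b : ℝ), W q :=
  Finset.sum_le_sum_of_subset_of_nonneg (primesUpTo_natCast_subset hab) fun _ hq _ =>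
    (W_pos (mem_primesUpTo_natCast.1 hq).1.two_le).le

theorem sum_W_lt_sum_W {a b p : ℕ} (hp : p.Prime) (hap : a < p) (hpb : p ≤ b) :
    ∑ q ∈ primesUpTo (a : ℝ), W q < ∑ q ∈ primesUpTo (b : ℝ), W q :=
  Finset.sum_lt_sum_of_subset (primesUpTo_natCast_subset (hap.le.trans hpb))
    (mem_primesUpTo_natCast.2 ⟨hp, hpb⟩)
    (fun h => hap.not_ge (mem_primesUpTo_natCast.1 h).2) (W_pos hp.two_le)
    fun _ hq _ => (W_pos (mem_primesUpTo_natCast.1 hq).1.two_le).le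

theorem primesUpTo_natCast_succ_subset (b : ℕ) :
    primesUpTo ((b + 1 : ℕ) : ℝ) ⊆ insert (b + 1) (primesUpTo (b : ℝ)) := fun q hq => by
  rw [Finset.mem_insert, mem_primesUpTo_natCast]
  have := mem_primesUpTo_natCast.1 hq
  rcases this.2.eq_or_lt with h | h
  · exact .inl h
  · exact .inr ⟨this.1, Nat.lt_succ_iff.1 h⟩

theorem sum_W_le_sum_W_add {a b : ℕ} (ha : 0 < a) (hab : a ≤ b) :
    ∑ q ∈ primesUpTo (b : ℝ), W q ≤
      ∑ q ∈ primesUpTo (a : ℝ), W q + (1 / (a : ℝ) - 1 / (b : ℝ)) := by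
  induction b, hab using Nat.le_induction with
  | base => simp
  | succ b hab ih =>
    have hb : 2 ≤ b + 1 := by omega
    have hW := W_le hb
    have hnot : b + 1 ∉ primesUpTo (b : ℝ) := fun h => by
      have := (mem_primesUpTo_natCast.1 h).2
      omega
    have hle : ∑ q ∈ primesUpTo ((b + 1 : ℕ) : ℝ), W q ≤
        W (b + 1) + ∑ q ∈ primesUpTo (b : ℝ), W q := by
      rw [← Finset.sum_insert hnot]
      refine Finset.sum_le_sum_of_subset_of_nonneg (primesUpTo_natCast_succ_subset b)
        fun q hq _ => ?_
      rcases Finset.mem_insert.1 hq with rfl | hq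
      · exact (W_pos hb).le
      · exact (W_pos (mem_primesUpTo_natCast.1 hq).1.two_le).le
    have hcast : ((b + 1 : ℕ) : ℝ) - 1 = b := by push_cast; ring
    rw [hcast] at hW
    linarith

theorem VN_bounds (N : ℕ) (hN : 1 ≤ N) :
    (∑' n : ℕ, if Practical n ∧ N < n then (1 / (n : ℝ)) * primeProd n else 0) *
        (∑ q ∈ primesUpTo (2 * N), W q) <
      (∑' n : ℕ, if Practical n ∧ N < n then
          (1 / (n : ℝ)) * (∑ q ∈ primesUpTo ((sigma1 n : ℝ) + 1), W q) * primeProd n else 0) ∧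
    (∑' n : ℕ, if Practical n ∧ N < n then
        (1 / (n : ℝ)) * (∑ q ∈ primesUpTo ((sigma1 n : ℝ) + 1), W q) * primeProd n else 0) <
      (∑' n : ℕ, if Practical n ∧ N < n then (1 / (n : ℝ)) * primeProd n else 0) *
        ((∑ q ∈ primesUpTo (2 * N), W q) + 1 / (2 * N)) := by
  have hθ : ∀ n : ℕ, (sigma1 n : ℝ) + 1 = ((sigma1 n + 1 : ℕ) : ℝ) := fun n => by push_cast; rfl
  have h2N : (2 * N : ℝ) = ((2 * N : ℕ) : ℝ) := by push_cast; rfl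
  have hbound : ∀ n : ℕ, Practical n → N < n → 2 * N ≤ sigma1 n + 1 := fun n hn hNn => by
    have := hn.two_mul_le (by omega)
    omega
  have hlow : ∀ n : ℕ, Practical n → N < n → ∑ q ∈ primesUpTo (2 * N), W q ≤
      ∑ q ∈ primesUpTo ((sigma1 n : ℝ) + 1), W q := fun n hn hNn => by
    rw [hθ, h2N]
    exact sum_W_le_sum_W (hbound n hn hNn)
  have hupp : ∀ n : ℕ, Practical n → N < n → ∑ q ∈ primesUpTo ((sigma1 n : ℝ) + 1), W q <
      ∑ q ∈ primesUpTo (2 * N), W q + 1 / (2 * N) := fun n hn hNn => by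
    have h := sum_W_le_sum_W_add (by omega) (hbound n hn hNn)
    have hpos : 0 < 1 / ((sigma1 n + 1 : ℕ) : ℝ) := by positivity
    rw [hθ, h2N]
    linarith
  have hcoef : ∀ n : ℕ, N < n → 0 < 1 / (n : ℝ) * primeProd n := fun n hn => by
    have hn0 : (0 : ℝ) < n := by exact_mod_cast (Nat.zero_le N).trans_lt hn
    exact mul_pos (one_div_pos.2 hn0) (primeProd_pos n)
  have hWnonneg : ∀ n : ℕ, 0 ≤ ∑ q ∈ primesUpTo ((sigma1 n : ℝ) + 1), W q := fun n =>
    Finset.sum_nonneg fun q hq => (W_pos (mem_primesUpTo_theta.1 hq).1.two_le).le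
  obtain ⟨p, hNp, hp⟩ := Nat.exists_infinite_primes (2 * N + 1)
  have hpow : p < 2 ^ p := Nat.lt_two_pow_self
  have hNpow : N < 2 ^ p := by omega
  have hprac := practical_two_pow p
  have hε := summable_practical_tail N
  have hupp_le : ∀ n : ℕ, (if Practical n ∧ N < n then
      (1 / (n : ℝ)) * (∑ q ∈ primesUpTo ((sigma1 n : ℝ) + 1), W q) * primeProd n else 0) ≤
      (if Practical n ∧ N < n then (1 / (n : ℝ)) * primeProd n else 0) *
        ((∑ q ∈ primesUpTo (2 * N), W q) + 1 / (2 * N)) := fun n => by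
    split_ifs with h
    · rw [mul_right_comm]
      exact mul_le_mul_of_nonneg_left (hupp n h.1 h.2).le (hcoef n h.2).le
    · simp
  have hV : Summable fun n : ℕ => if Practical n ∧ N < n then
      (1 / (n : ℝ)) * (∑ q ∈ primesUpTo ((sigma1 n : ℝ) + 1), W q) * primeProd n else 0 := by
    refine .of_nonneg_of_le (fun n => ?_) hupp_le (hε.mul_right _)
    split_ifs with h
    · rw [mul_right_comm]
      exact mul_nonneg (hcoef n h.2).le (hWnonneg n)
    · rfl
  rw [← tsum_mul_right, ← tsum_mul_right]
  constructor
  · refine (hε.mul_right _).tsum_lt_tsum (i := 2 ^ p) (fun n => ?_) ?_ hV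
    · dsimp only
      split_ifs with h
      · rw [mul_right_comm _ _ (primeProd n)]
        exact mul_le_mul_of_nonneg_left (hlow n h.1 h.2) (hcoef n h.2).le
      · simp
    · rw [if_pos ⟨hprac, hNpow⟩, if_pos ⟨hprac, hNpow⟩, mul_right_comm _ _ (primeProd _), hθ, h2N]
      have := self_le_sigma1 hprac.1
      exact mul_lt_mul_of_pos_left (sum_W_lt_sum_W hp (by omega) (by omega)) (hcoef _ hNpow)
  · refine hV.tsum_lt_tsum (i := 2 ^ p) hupp_le ?_ (hε.mul_right _)
    rw [if_pos ⟨hprac, hNpow⟩, if_pos ⟨hprac, hNpow⟩, mul_right_comm]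
    exact mul_lt_mul_of_pos_left (hupp _ hprac hNpow) (hcoef _ hNpow)
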